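/- For every real number q ≥ 2 the family of weights (w(α)^(-q)), indexed by all finitely supported multi-indices α : ℕ →₀ ℕ, is summable; that is, Σ_α ∏_j (2(j+1))^(-q·(α j)) < ∞, so that the constant A(q) = (Σ_α w(α)^(-q))^(1/2) is a finite real number. -/

import Mathlib

/-- Euler-product style summability over finitely supported multi-indices. -/
theorem summable_multi (x : ℕ → ℝ) (h0 : ∀ j, 0 ≤ x j) (h1 : ∀ j, x j ≤ 1 / 2)
    (hx : Summable x) : Summable fun α : ℕ →₀ ℕ => α.prod fun j m => x j ^ m := by
  classical
  refine summable_of_sum_le (c := Real.exp (2 * ∑' j, x j)) ?_ ?_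
  · intro α
    exact Finset.prod_nonneg fun j _ => pow_nonneg (h0 j) _
  intro s
  obtain ⟨J, hJ⟩ : ∃ J : ℕ, ∀ α ∈ s, α.support ⊆ Finset.range J := by
    obtain ⟨J, hJ⟩ := (s.biUnion fun α => α.support).exists_nat_subset_range
    exact ⟨J, fun α hα => (Finset.subset_biUnion_of_mem (fun α : ℕ →₀ ℕ => α.support) hα).trans hJ⟩
  obtain ⟨N, hN⟩ : ∃ N : ℕ, ∀ α ∈ s, ∀ j, α j ∈ Finset.range N := by
    obtain ⟨N, hN⟩ := (s.biUnion fun α => (Finset.range J).image α).exists_nat_subset_range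
    refine ⟨N + 1, fun α hα j => ?_⟩
    by_cases hj : j ∈ Finset.range J
    · have := hN (Finset.mem_biUnion.2 ⟨α, hα, Finset.mem_image_of_mem _ hj⟩)
      simp at this ⊢
      omega
    · have : α j = 0 := by
        by_contra h
        exact hj (hJ α hα (Finsupp.mem_support_iff.2 h))
      simp [this]
  have hgeo : ∀ j, ∑ m ∈ Finset.range N, x j ^ m ≤ Real.exp (2 * x j) := by
    intro j
    have hlt : x j < 1 := by linarith [h1 j]
    have h2 : ∑ m ∈ Finset.range N, x j ^ m ≤ (1 - x j)⁻¹ := by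
      rw [← tsum_geometric_of_lt_one (h0 j) hlt]
      exact (summable_geometric_of_lt_one (h0 j) hlt).sum_le_tsum _
        fun m _ => pow_nonneg (h0 j) m
    have h3 : (1 - x j)⁻¹ ≤ 2 * x j + 1 := by
      rw [inv_le_iff_one_le_mul₀ (by linarith)]
      nlinarith [h0 j, h1 j]
    linarith [Real.add_one_le_exp (2 * x j)]
  have hinj : Set.InjOn (fun (α : ℕ →₀ ℕ) (i : Fin J) => α i) s := by
    intro α hα β hβ h
    ext j
    by_cases hj : j < J
    · exact congrFun h ⟨j, hj⟩
    · have e : ∀ γ ∈ s, γ j = 0 := fun γ hγ => by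
        by_contra hne
        exact hj (Finset.mem_range.1 (hJ γ hγ (Finsupp.mem_support_iff.2 hne)))
      rw [e α hα, e β hβ]
  calc ∑ α ∈ s, α.prod (fun j m => x j ^ m)
      = ∑ α ∈ s, ∏ i : Fin J, x i ^ α i := by
        refine Finset.sum_congr rfl fun α hα => ?_
        rw [Finsupp.prod_of_support_subset α (hJ α hα) _ (by simp), Finset.prod_range]
    _ = ∑ p ∈ s.image (fun (α : ℕ →₀ ℕ) (i : Fin J) => α i), ∏ i : Fin J, x i ^ p i := by
        rw [Finset.sum_image hinj]
    _ ≤ ∑ p ∈ Fintype.piFinset (fun _ : Fin J => Finset.range N), ∏ i : Fin J, x i ^ p i := by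
        refine Finset.sum_le_sum_of_subset_of_nonneg ?_ fun p _ _ =>
          Finset.prod_nonneg fun i _ => pow_nonneg (h0 i) _
        intro p hp
        obtain ⟨α, hα, rfl⟩ := Finset.mem_image.1 hp
        exact Fintype.mem_piFinset.2 fun i => hN α hα i
    _ = ∏ i : Fin J, ∑ m ∈ Finset.range N, x i ^ m := (Finset.prod_univ_sum _ _).symm
    _ ≤ ∏ i : Fin J, Real.exp (2 * x i) :=
        Finset.prod_le_prod (fun i _ => Finset.sum_nonneg fun m _ => pow_nonneg (h0 i) m)
          fun i _ => hgeo i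
    _ = Real.exp (2 * ∑ j ∈ Finset.range J, x j) := by
        rw [← Real.exp_sum, Finset.mul_sum, Finset.sum_range]
    _ ≤ Real.exp (2 * ∑' j, x j) := by
        have := hx.sum_le_tsum (Finset.range J) fun j _ => h0 j
        gcongr

/-- For every real `q ≥ 2` the family `α ↦ ∏_j (2(j+1))^(-q·(α j))`,
indexed by all finitely supported multi-indices `α : ℕ →₀ ℕ`, is summable
(so that `A(q) = (Σ_α w(α)^(-q))^(1/2)` is a finite real number). -/
theorem statement0 (q : ℝ) (hq : 2 ≤ q) :
    Summable fun α : ℕ →₀ ℕ => α.prod fun j m => (2 * ((j : ℝ) + 1)) ^ (-(q * (m : ℝ))) := by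
  have hle : ∀ j : ℕ, (2 * ((j : ℝ) + 1)) ^ (-q) ≤ 1 / 4 * (1 / ((j + 1 : ℕ) : ℝ) ^ 2) := by
    intro j
    have hj : (0 : ℝ) ≤ j := j.cast_nonneg
    calc (2 * ((j : ℝ) + 1)) ^ (-q) ≤ (2 * ((j : ℝ) + 1)) ^ (-2 : ℝ) :=
          Real.rpow_le_rpow_of_exponent_le (by linarith) (by linarith)
      _ = 1 / 4 * (1 / ((j + 1 : ℕ) : ℝ) ^ 2) := by
          rw [Real.rpow_neg (by positivity)]
          norm_cast
          push_cast
          field_simp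
          norm_num
  have h0 : ∀ j : ℕ, 0 ≤ (2 * ((j : ℝ) + 1)) ^ (-q) := fun j => by positivity
  have key := summable_multi (fun j : ℕ => (2 * ((j : ℝ) + 1)) ^ (-q)) h0 ?_ ?_
  · convert key using 4 with α j
    funext m
    rw [← Real.rpow_mul_natCast (by positivity)]
    rw [neg_mul]
  · intro j
    refine (hle j).trans ?_
    have : 1 / ((j + 1 : ℕ) : ℝ) ^ 2 ≤ 1 := by
      rw [div_le_one (by positivity)]
      exact one_le_pow₀ (by push_cast; linarith [(j.cast_nonneg : (0 : ℝ) ≤ j)])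
    linarith
  · refine Summable.of_nonneg_of_le h0 hle (Summable.mul_left _ ?_)
    exact (summable_nat_add_iff 1).2 (Real.summable_one_div_nat_pow.2 one_lt_two)
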